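/- Prototype B attribute recovery, case (i) (Claim): For every constant k ≥ 1 there exist constants C ≥ 1 and c > 0 such that the following holds. Let N ≥ 2, d ≤ N^k, m ≤ N, and consider the prototype-B sketch s = Σ_{j=1}^m w_j·((I + R_j)/2)·((1/2)R_{M(j),1}x_j + (1/2)R_{M(j),2}e₁) with all matrices independent Haar-random elements of O(d). If M* is a module index such that exactly one object j* has M(j*) = M* and w_{j*} > 0, then Pr[ ‖(4/w_{j*})·R_{M*,1}ᵀ s − x_{j*}‖_∞ > C·√(log N)/(w_{j*}·√d) ] ≤ N^{−c}. -/

import Mathlib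

open MeasureTheory Matrix

noncomputable instance (d : ℕ) : MeasurableSpace (Matrix.orthogonalGroup (Fin d) ℝ) :=
  borel _

instance (d : ℕ) : BorelSpace (Matrix.orthogonalGroup (Fin d) ℝ) := ⟨rfl⟩

/-- The squared Euclidean norm `‖v‖²` on `ℝ^d`. -/
def sqNorm {d : ℕ} (v : Fin d → ℝ) : ℝ := ∑ i, v i ^ 2

/-- The `ℓ∞` norm (maximum absolute coordinate) on `ℝ^d`. -/
noncomputable def linf {d : ℕ} (v : Fin d → ℝ) : ℝ := ⨆ i, |v i|

/-- The first standard basis vector `e₁ ∈ ℝ^d`. -/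
def e1 {d : ℕ} : Fin d → ℝ := fun i => if (i : ℕ) = 0 then 1 else 0

/-- The prototype-B overall sketch
`s = Σ_j w_j·((I + R_j)/2)·((1/2)R_{M(j),1}x_j + (1/2)R_{M(j),2}e₁)`, where `R1 M`/`R2 M` are
the two module matrices of module `M` and `Rt j` is the tuple matrix of object position `j`. -/
noncomputable def sketchB {N d m : ℕ} (M : Fin m → Fin N) (x : Fin m → Fin d → ℝ)
    (w : Fin m → ℝ)
    (R1 R2 : Fin N → Matrix.orthogonalGroup (Fin d) ℝ)
    (Rt : Fin m → Matrix.orthogonalGroup (Fin d) ℝ) : Fin d → ℝ :=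
  ∑ j, w j • ((2⁻¹ : ℝ) • (1 + (Rt j : Matrix (Fin d) (Fin d) ℝ))).mulVec
    ((2⁻¹ : ℝ) • (R1 (M j) : Matrix (Fin d) (Fin d) ℝ).mulVec (x j) +
      (2⁻¹ : ℝ) • (R2 (M j) : Matrix (Fin d) (Fin d) ℝ).mulVec e1)

abbrev OG (d : ℕ) := Matrix.orthogonalGroup (Fin d) ℝ

lemma OG_dot {d : ℕ} (Q : OG d) (u v : Fin d → ℝ) :
    ((Q : Matrix (Fin d) (Fin d) ℝ) *ᵥ u) ⬝ᵥ ((Q : Matrix (Fin d) (Fin d) ℝ) *ᵥ v) = u ⬝ᵥ v := by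
  have h : (Q : Matrix (Fin d) (Fin d) ℝ)ᵀ * (Q : Matrix (Fin d) (Fin d) ℝ) = 1 := by
    have := (Matrix.mem_orthogonalGroup_iff' (Fin d) ℝ).1 Q.2
    exact this
  rw [Matrix.dotProduct_mulVec, ← Matrix.mulVec_transpose, Matrix.mulVec_mulVec, h,
    Matrix.one_mulVec]

lemma OG_tmul {d : ℕ} (Q : OG d) (u : Fin d → ℝ) :
    (Q : Matrix (Fin d) (Fin d) ℝ)ᵀ *ᵥ ((Q : Matrix (Fin d) (Fin d) ℝ) *ᵥ u) = u := by
  have h : (Q : Matrix (Fin d) (Fin d) ℝ)ᵀ * (Q : Matrix (Fin d) (Fin d) ℝ) = 1 := by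
    have := (Matrix.mem_orthogonalGroup_iff' (Fin d) ℝ).1 Q.2
    exact this
  rw [Matrix.mulVec_mulVec, h, Matrix.one_mulVec]

/-- Transitivity of the orthogonal group on spheres (Householder reflection). -/
lemma OG_trans {d : ℕ} (u v : Fin d → ℝ) (h : u ⬝ᵥ u = v ⬝ᵥ v) :
    ∃ Q : OG d, (Q : Matrix (Fin d) (Fin d) ℝ) *ᵥ u = v := by
  by_cases huv : u = v
  · exact ⟨1, by simp [huv]⟩
  set z := u - v with hz
  have hz0 : z ⬝ᵥ z ≠ 0 := by
    rw [Ne, dotProduct_self_eq_zero]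
    exact sub_ne_zero.2 huv
  set a : ℝ := 2 / (z ⬝ᵥ z) with ha
  have haz : a * (z ⬝ᵥ z) = 2 := by rw [ha]; field_simp
  have hsq : vecMulVec z z * vecMulVec z z = (z ⬝ᵥ z) • vecMulVec z z := by
    rw [Matrix.vecMulVec_mul_vecMulVec]
    ext i j
    simp [Matrix.vecMulVec_apply]
    ring
  have hmem : (1 - a • vecMulVec z z : Matrix (Fin d) (Fin d) ℝ) ∈
      Matrix.orthogonalGroup (Fin d) ℝ := by
    rw [Matrix.mem_orthogonalGroup_iff]
    have : (1 - a • vecMulVec z z : Matrix (Fin d) (Fin d) ℝ)ᵀ = 1 - a • vecMulVec z z := by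
      ext i j
      simp [Matrix.vecMulVec_apply, Matrix.one_apply, mul_comm, eq_comm]
    rw [this]
    have : (1 - a • vecMulVec z z : Matrix (Fin d) (Fin d) ℝ) * (1 - a • vecMulVec z z)
       = 1 + (a * (a * (z ⬝ᵥ z)) - 2 * a) • vecMulVec z z := by
      rw [mul_sub, sub_mul, sub_mul, smul_mul_smul_comm, hsq]
      simp only [one_mul, mul_one, sub_smul, smul_smul, two_mul, add_smul]
      rw [mul_assoc]
      abel
    rw [this, haz, mul_comm, sub_self, zero_smul, add_zero]
  refine ⟨⟨_, hmem⟩, ?_⟩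
  have hzu : 2 * (z ⬝ᵥ u) = z ⬝ᵥ z := by
    simp only [hz, sub_dotProduct, dotProduct_sub, ← h, dotProduct_comm v u]
    ring
  have hk : a * (z ⬝ᵥ u) = 1 := by
    rw [← hzu] at haz; linarith
  change (1 - a • vecMulVec z z : Matrix (Fin d) (Fin d) ℝ) *ᵥ u = v
  rw [Matrix.sub_mulVec, Matrix.one_mulVec, Matrix.smul_mulVec, Matrix.vecMulVec_mulVec]
  ext i
  simp only [Pi.sub_apply, Pi.smul_apply, smul_eq_mul, MulOpposite.smul_eq_mul_unop,
    MulOpposite.unop_op]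
  have : a * (z i * (z ⬝ᵥ u)) = z i := by
    rw [mul_left_comm, hk, mul_one]
  rw [this, hz]
  simp

lemma OG_cont_mulVec {d : ℕ} (v : Fin d → ℝ) :
    Continuous fun R : OG d => (R : Matrix (Fin d) (Fin d) ℝ) *ᵥ v :=
  Continuous.matrix_mulVec continuous_subtype_val continuous_const

lemma OG_meas_exp {d : ℕ} (u v : Fin d → ℝ) :
    Measurable fun R : OG d =>
      ENNReal.ofReal (Real.exp (u ⬝ᵥ (R : Matrix (Fin d) (Fin d) ℝ) *ᵥ v)) := by
  have : Continuous fun R : OG d => u ⬝ᵥ (R : Matrix (Fin d) (Fin d) ℝ) *ᵥ v :=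
    Continuous.dotProduct continuous_const (OG_cont_mulVec v)
  exact ENNReal.measurable_ofReal.comp (Real.measurable_exp.comp this.measurable)

instance OG_sc (d : ℕ) : SecondCountableTopology (OG d) := by
  have : SecondCountableTopology (Matrix (Fin d) (Fin d) ℝ) :=
    inferInstanceAs (SecondCountableTopology (Fin d → Fin d → ℝ))
  exact TopologicalSpace.Subtype.secondCountableTopology _

instance OG_measMul (d : ℕ) : MeasurableMul₂ (OG d) := inferInstance

lemma mgf_inv {d : ℕ} (μ : Measure (OG d)) [μ.IsMulLeftInvariant] (u u' v : Fin d → ℝ)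
    (h : u ⬝ᵥ u = u' ⬝ᵥ u') :
    ∫⁻ R : OG d, ENNReal.ofReal (Real.exp (u ⬝ᵥ (R : Matrix (Fin d) (Fin d) ℝ) *ᵥ v)) ∂μ =
    ∫⁻ R : OG d, ENNReal.ofReal (Real.exp (u' ⬝ᵥ (R : Matrix (Fin d) (Fin d) ℝ) *ᵥ v)) ∂μ := by
  obtain ⟨Q, hQ⟩ := OG_trans u u' h
  rw [← lintegral_mul_left_eq_self (μ := μ) _ Q]
  conv_rhs => rw [← lintegral_mul_left_eq_self (μ := μ) _ Q]
  rw [lintegral_mul_left_eq_self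
    (fun R : OG d => ENNReal.ofReal (Real.exp (u ⬝ᵥ (R : Matrix (Fin d) (Fin d) ℝ) *ᵥ v))) Q]
  congr 1
  ext R
  have : ((Q * R : OG d) : Matrix (Fin d) (Fin d) ℝ) *ᵥ v =
    (Q : Matrix (Fin d) (Fin d) ℝ) *ᵥ ((R : Matrix (Fin d) (Fin d) ℝ) *ᵥ v) := by
    rw [Matrix.mulVec_mulVec]; rfl
  rw [this, ← hQ, OG_dot]

/-- Rademacher averaging. -/
lemma rademacher_avg {d : ℕ} (a : ℝ) (y : Fin d → ℝ) :
    ∑ ε : Fin d → Bool, Real.exp ((fun i => a * (if ε i then 1 else -1)) ⬝ᵥ y)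
      ≤ 2 ^ d * Real.exp (a ^ 2 * (y ⬝ᵥ y) / 2) := by
  have h1 : ∑ ε : Fin d → Bool, Real.exp ((fun i => a * (if ε i then 1 else -1)) ⬝ᵥ y)
      = ∏ i : Fin d, ∑ b : Bool, Real.exp (a * (if b then 1 else -1) * y i) := by
    rw [Finset.prod_univ_sum, Fintype.piFinset_univ]
    refine Finset.sum_congr rfl fun ε _ => ?_
    rw [← Real.exp_sum]
    rfl
  rw [h1]
  have h2 : ∀ i, ∑ b : Bool, Real.exp (a * (if b then 1 else -1) * y i)
      ≤ 2 * Real.exp ((a * y i) ^ 2 / 2) := by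
    intro i
    have := Real.cosh_le_exp_half_sq (a * y i)
    rw [Real.cosh_eq] at this
    simp only [Fintype.sum_bool, if_true]
    simp only [mul_one, mul_neg, neg_mul, Bool.false_eq_true, if_false]
    linarith
  calc _ ≤ ∏ i : Fin d, (2 * Real.exp ((a * y i) ^ 2 / 2)) :=
        Finset.prod_le_prod (fun i _ => Finset.sum_nonneg fun _ _ => (Real.exp_pos _).le)
          (fun i _ => h2 i)
    _ = _ := by
        rw [Finset.prod_mul_distrib, ← Real.exp_sum]
        simp only [Finset.prod_const, Finset.card_univ, Fintype.card_fin]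
        congr 2
        simp only [dotProduct, Finset.mul_sum, Finset.sum_div]
        refine Finset.sum_congr rfl fun i _ => ?_
        ring

lemma mgf_bound {d : ℕ} (hd : 0 < d) (μ : Measure (OG d)) [μ.IsMulLeftInvariant]
    [IsProbabilityMeasure μ] (u v : Fin d → ℝ) :
    ∫⁻ R : OG d, ENNReal.ofReal (Real.exp (u ⬝ᵥ (R : Matrix (Fin d) (Fin d) ℝ) *ᵥ v)) ∂μ ≤
      ENNReal.ofReal (Real.exp ((u ⬝ᵥ u) * (v ⬝ᵥ v) / (2 * d))) := by
  have hdR : (0 : ℝ) < d := by exact_mod_cast hd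
  have huu : 0 ≤ u ⬝ᵥ u := Finset.sum_nonneg fun i _ => mul_self_nonneg _
  set a : ℝ := Real.sqrt ((u ⬝ᵥ u) / d) with ha
  have ha2 : a ^ 2 = (u ⬝ᵥ u) / d := Real.sq_sqrt (by positivity)
  set E : (Fin d → Bool) → Fin d → ℝ := fun ε i => a * (if ε i then 1 else -1) with hE
  have hEE : ∀ ε, u ⬝ᵥ u = E ε ⬝ᵥ E ε := by
    intro ε
    have : E ε ⬝ᵥ E ε = ∑ i : Fin d, a ^ 2 := by
      refine Finset.sum_congr rfl fun i _ => ?_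
      simp only [hE]
      split_ifs <;> ring
    rw [this, ha2]
    simp
    field_simp
  set I := ∫⁻ R : OG d, ENNReal.ofReal (Real.exp (u ⬝ᵥ (R : Matrix (Fin d) (Fin d) ℝ) *ᵥ v)) ∂μ
    with hI
  have hsum : (2 ^ d : ENNReal) * I ≤
      2 ^ d * ENNReal.ofReal (Real.exp ((u ⬝ᵥ u) * (v ⬝ᵥ v) / (2 * d))) := by
    calc (2 ^ d : ENNReal) * I = ∑ ε : Fin d → Bool, I := by
          simp
      _ = ∑ ε : Fin d → Bool, ∫⁻ R : OG d,
            ENNReal.ofReal (Real.exp (E ε ⬝ᵥ (R : Matrix (Fin d) (Fin d) ℝ) *ᵥ v)) ∂μ :=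
          Finset.sum_congr rfl fun ε _ => mgf_inv μ u (E ε) v (hEE ε)
      _ = ∫⁻ R : OG d, ∑ ε : Fin d → Bool,
            ENNReal.ofReal (Real.exp (E ε ⬝ᵥ (R : Matrix (Fin d) (Fin d) ℝ) *ᵥ v)) ∂μ :=
          (lintegral_finsetSum _ fun ε _ => OG_meas_exp (E ε) v).symm
      _ ≤ ∫⁻ R : OG d, 2 ^ d * ENNReal.ofReal (Real.exp ((u ⬝ᵥ u) * (v ⬝ᵥ v) / (2 * d))) ∂μ := by
          refine lintegral_mono fun R => ?_
          rw [← ENNReal.ofReal_sum_of_nonneg fun _ _ => (Real.exp_pos _).le]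
          have h := rademacher_avg a ((R : Matrix (Fin d) (Fin d) ℝ) *ᵥ v)
          rw [OG_dot, ha2] at h
          have h2 : (2 ^ d : ENNReal) = ENNReal.ofReal (2 ^ d) := by
            rw [ENNReal.ofReal_pow (by norm_num)]; simp
          rw [h2, ← ENNReal.ofReal_mul (by positivity)]
          refine ENNReal.ofReal_le_ofReal (h.trans_eq ?_)
          congr 2
          field_simp
      _ = _ := by simp
  exact (ENNReal.mul_le_mul_iff_right (by simp) (by simp)).1 hsum

/-- Sub-Gaussian tail. -/
lemma tail_bound {d : ℕ} (hd : 0 < d) (μ : Measure (OG d)) [μ.IsMulLeftInvariant]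
    [IsProbabilityMeasure μ] (u v : Fin d → ℝ) (K T : ℝ) (hT : 0 ≤ T) (hK : 0 < K)
    (huv : (u ⬝ᵥ u) * (v ⬝ᵥ v) ≤ K) :
    μ {R : OG d | T / Real.sqrt d < u ⬝ᵥ (R : Matrix (Fin d) (Fin d) ℝ) *ᵥ v} ≤
      ENNReal.ofReal (Real.exp (- T ^ 2 / (2 * K))) := by
  have hdR : (0 : ℝ) < d := by exact_mod_cast hd
  set l : ℝ := Real.sqrt d * T / K with hl
  have hl0 : 0 ≤ l := by positivity
  have hs : Real.sqrt d ^ 2 = d := Real.sq_sqrt hdR.le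
  have hs0 : 0 < Real.sqrt d := Real.sqrt_pos.2 hdR
  have hm := mgf_bound hd μ (l • u) v
  have hmk := mul_meas_ge_le_lintegral₀ (μ := μ) (OG_meas_exp (l • u) v).aemeasurable
    (ENNReal.ofReal (Real.exp (T ^ 2 / K)))
  have hsub : {R : OG d | T / Real.sqrt d < u ⬝ᵥ (R : Matrix (Fin d) (Fin d) ℝ) *ᵥ v} ⊆
     {R : OG d | ENNReal.ofReal (Real.exp (T ^ 2 / K)) ≤
      ENNReal.ofReal (Real.exp ((l • u) ⬝ᵥ (R : Matrix (Fin d) (Fin d) ℝ) *ᵥ v))} := by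
    intro R hR
    simp only [Set.mem_ofPred_eq] at hR ⊢
    refine ENNReal.ofReal_le_ofReal (Real.exp_le_exp.2 ?_)
    rw [smul_dotProduct, smul_eq_mul]
    calc T ^ 2 / K = l * (T / Real.sqrt d) := by rw [hl]; field_simp
      _ ≤ _ := mul_le_mul_of_nonneg_left hR.le hl0
  have h3 : ENNReal.ofReal (Real.exp (T ^ 2 / K)) *
      μ {R : OG d | T / Real.sqrt d < u ⬝ᵥ (R : Matrix (Fin d) (Fin d) ℝ) *ᵥ v} ≤
      ENNReal.ofReal (Real.exp (T ^ 2 / K)) * ENNReal.ofReal (Real.exp (- T ^ 2 / (2 * K))) := by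
    refine (mul_le_mul_right (measure_mono hsub) _).trans (hmk.trans (hm.trans ?_))
    rw [← ENNReal.ofReal_mul (Real.exp_pos _).le, ← Real.exp_add]
    refine ENNReal.ofReal_le_ofReal (Real.exp_le_exp.2 ?_)
    have h4 : (l • u) ⬝ᵥ (l • u) * (v ⬝ᵥ v) / (2 * d) = l ^ 2 / (2 * d) * ((u ⬝ᵥ u) * (v ⬝ᵥ v)) := by
      simp only [smul_dotProduct, dotProduct_smul, smul_eq_mul]; ring
    rw [h4]
    refine (mul_le_mul_of_nonneg_left huv (by positivity)).trans_eq ?_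
    rw [hl, div_pow, mul_pow, hs]
    field_simp
    ring
  refine (ENNReal.mul_le_mul_iff_right ?_ ENNReal.ofReal_ne_top).1 h3
  simp [Real.exp_pos]

/-- Averaging over a random left translation. -/
lemma translate_bound {Y H : Type*} [MeasurableSpace Y] [MeasurableSpace H] [Group H]
    [MeasurableMul₂ H] (μ : Measure Y) [IsProbabilityMeasure μ] (P : Measure H)
    [IsProbabilityMeasure P] [P.IsMulLeftInvariant] (g : Y → H) (hg : Measurable g)
    (A : Set H) (hA : MeasurableSet A) (b : ENNReal) (h : ∀ x, μ {q | g q * x ∈ A} ≤ b) :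
    P A ≤ b := by
  have hS : MeasurableSet {p : Y × H | g p.1 * p.2 ∈ A} :=
    ((hg.comp measurable_fst).mul measurable_snd) hA
  have h1 : (μ.prod P) {p : Y × H | g p.1 * p.2 ∈ A} = P A := by
    rw [Measure.prod_apply hS]
    have : ∀ q, P (Prod.mk q ⁻¹' {p : Y × H | g p.1 * p.2 ∈ A}) = P A := fun q =>
      measure_preimage_mul P (g q) A
    rw [lintegral_congr this]
    simp
  rw [← h1, Measure.prod_apply_symm hS]
  calc _ ≤ ∫⁻ x, b ∂P := lintegral_mono fun x => h x
    _ = b := by simp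

noncomputable def nrm {d : ℕ} (v : Fin d → ℝ) : ℝ := ‖WithLp.toLp 2 v‖

lemma nrm_sq {d : ℕ} (v : Fin d → ℝ) : nrm v ^ 2 = v ⬝ᵥ v := by
  rw [nrm, EuclideanSpace.norm_sq_eq]
  refine Finset.sum_congr rfl fun i _ => ?_
  simp [sq]

lemma nrm_nonneg {d : ℕ} (v : Fin d → ℝ) : 0 ≤ nrm v := norm_nonneg _

lemma nrm_add_le {d : ℕ} (u v : Fin d → ℝ) : nrm (u + v) ≤ nrm u + nrm v :=
  norm_add_le (WithLp.toLp 2 u) (WithLp.toLp 2 v)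

lemma nrm_smul {d : ℕ} (a : ℝ) (v : Fin d → ℝ) : nrm (a • v) = |a| * nrm v :=
  norm_smul a (WithLp.toLp 2 v)

lemma nrm_sum_le {d : ℕ} {ι : Type*} (s : Finset ι) (f : ι → Fin d → ℝ) :
    nrm (∑ j ∈ s, f j) ≤ ∑ j ∈ s, nrm (f j) := by
  rw [nrm, WithLp.toLp_sum]
  exact norm_sum_le _ _

lemma nrm_OG {d : ℕ} (Q : OG d) (v : Fin d → ℝ) :
    nrm ((Q : Matrix (Fin d) (Fin d) ℝ) *ᵥ v) = nrm v := by
  have h : nrm ((Q : Matrix (Fin d) (Fin d) ℝ) *ᵥ v) ^ 2 = nrm v ^ 2 := by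
    rw [nrm_sq, nrm_sq, OG_dot]
  exact (pow_left_inj₀ (nrm_nonneg _) (nrm_nonneg _) two_ne_zero).1 h

lemma nrm_unit {d : ℕ} (v : Fin d → ℝ) (h : sqNorm v = 1) : nrm v = 1 := by
  have h2 : nrm v ^ 2 = 1 ^ 2 := by
    rw [nrm_sq, one_pow, ← h]
    exact Finset.sum_congr rfl fun i _ => (sq _).symm
  exact (pow_left_inj₀ (nrm_nonneg _) zero_le_one two_ne_zero).1 h2

lemma nrm_e1 {d : ℕ} (hd : 0 < d) : nrm (e1 : Fin d → ℝ) = 1 := by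
  apply nrm_unit
  rw [sqNorm, Finset.sum_eq_single (⟨0, hd⟩ : Fin d)]
  · simp [e1]
  · intro b _ hb
    have : (b : ℕ) ≠ 0 := fun h => hb (Fin.ext h)
    simp [e1, this]
  · simp

abbrev Om (N d m : ℕ) := (Fin N → OG d) × (Fin N → OG d) × (Fin m → OG d)

/-- Twice the object sketch. -/
noncomputable def objB {N d m : ℕ} (M : Fin m → Fin N) (x : Fin m → Fin d → ℝ)
    (ω : Om N d m) (j : Fin m) : Fin d → ℝ :=
  (ω.1 (M j) : Matrix (Fin d) (Fin d) ℝ) *ᵥ x j + (ω.2.1 (M j) : Matrix (Fin d) (Fin d) ℝ) *ᵥ e1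

/-- The noise part that is independent of the first matrix of the module of `js`. -/
noncomputable def restB {N d m : ℕ} (M : Fin m → Fin N) (x : Fin m → Fin d → ℝ)
    (w : Fin m → ℝ) (js : Fin m) (ω : Om N d m) : Fin d → ℝ :=
  w js • (ω.2.1 (M js) : Matrix (Fin d) (Fin d) ℝ) *ᵥ e1 +
    ∑ j ∈ Finset.univ.erase js, w j • (objB M x ω j +
      (ω.2.2 j : Matrix (Fin d) (Fin d) ℝ) *ᵥ objB M x ω j)

lemma nrm_objB {N d m : ℕ} (hd : 0 < d) (M : Fin m → Fin N) (x : Fin m → Fin d → ℝ)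
    (hx : ∀ j, sqNorm (x j) = 1) (ω : Om N d m) (j : Fin m) : nrm (objB M x ω j) ≤ 2 := by
  refine (nrm_add_le _ _).trans ?_
  rw [nrm_OG, nrm_OG, nrm_unit _ (hx j), nrm_e1 hd]
  norm_num

lemma nrm_restB {N d m : ℕ} (hd : 0 < d) (M : Fin m → Fin N) (x : Fin m → Fin d → ℝ)
    (hx : ∀ j, sqNorm (x j) = 1) (w : Fin m → ℝ) (hw : ∀ j, 0 ≤ w j) (hw1 : ∑ j, w j = 1)
    (js : Fin m) (ω : Om N d m) : nrm (restB M x w js ω) ≤ 4 := by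
  have h1 : nrm (∑ j ∈ Finset.univ.erase js, w j • (objB M x ω j +
      (ω.2.2 j : Matrix (Fin d) (Fin d) ℝ) *ᵥ objB M x ω j)) ≤
      ∑ j ∈ Finset.univ.erase js, w j * 4 := by
    refine (nrm_sum_le _ _).trans (Finset.sum_le_sum fun j _ => ?_)
    rw [nrm_smul, abs_of_nonneg (hw j)]
    refine mul_le_mul_of_nonneg_left ((nrm_add_le _ _).trans ?_) (hw j)
    rw [nrm_OG]
    linarith [nrm_objB hd M x hx ω j]
  have h2 : w js + ∑ j ∈ Finset.univ.erase js, w j = 1 := by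
    rw [Finset.add_sum_erase _ _ (Finset.mem_univ js), hw1]
  refine (nrm_add_le _ _).trans ?_
  rw [nrm_smul, nrm_OG, nrm_e1 hd, abs_of_nonneg (hw js)]
  rw [← Finset.sum_mul] at h1
  nlinarith [hw js]

lemma four_sketch {N d m : ℕ} (M : Fin m → Fin N) (x : Fin m → Fin d → ℝ)
    (w : Fin m → ℝ) (js : Fin m) (ω : Om N d m) :
    (4 : ℝ) • sketchB M x w ω.1 ω.2.1 ω.2.2 =
      w js • (ω.1 (M js) : Matrix (Fin d) (Fin d) ℝ) *ᵥ x js +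
      ((ω.2.2 js : Matrix (Fin d) (Fin d) ℝ) *ᵥ (w js • objB M x ω js) + restB M x w js ω) := by
  have h : (4 : ℝ) • sketchB M x w ω.1 ω.2.1 ω.2.2 = ∑ j, w j • (objB M x ω j +
      (ω.2.2 j : Matrix (Fin d) (Fin d) ℝ) *ᵥ objB M x ω j) := by
    rw [sketchB, Finset.smul_sum]
    refine Finset.sum_congr rfl fun j _ => ?_
    rw [← smul_add, Matrix.smul_mulVec, Matrix.mulVec_smul, Matrix.add_mulVec, Matrix.one_mulVec,
      smul_smul, smul_smul, smul_smul, objB]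
    congr 1
    ring
  rw [h, ← Finset.add_sum_erase _ _ (Finset.mem_univ js), restB, Matrix.mulVec_smul]
  have : objB M x ω js = (ω.1 (M js) : Matrix (Fin d) (Fin d) ℝ) *ᵥ x js +
    (ω.2.1 (M js) : Matrix (Fin d) (Fin d) ℝ) *ᵥ e1 := rfl
  rw [smul_add (w js)]
  nth_rewrite 1 [this]
  rw [smul_add (w js)]
  abel

lemma err_eq {N d m : ℕ} (M : Fin m → Fin N) (x : Fin m → Fin d → ℝ)
    (w : Fin m → ℝ) (js : Fin m) (hw : 0 < w js) (ω : Om N d m) (i : Fin d) :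
    ((4 / w js) • (ω.1 (M js) : Matrix (Fin d) (Fin d) ℝ)ᵀ.mulVec
        (sketchB M x w ω.1 ω.2.1 ω.2.2) - x js) i =
    (((ω.1 (M js) : Matrix (Fin d) (Fin d) ℝ) *ᵥ Pi.single i 1) ⬝ᵥ
      ((ω.2.2 js : Matrix (Fin d) (Fin d) ℝ) *ᵥ (w js • objB M x ω js)) +
     restB M x w js ω ⬝ᵥ ((ω.1 (M js) : Matrix (Fin d) (Fin d) ℝ) *ᵥ Pi.single i 1)) / w js := by
  have h : (4 / w js) • (ω.1 (M js) : Matrix (Fin d) (Fin d) ℝ)ᵀ.mulVec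
        (sketchB M x w ω.1 ω.2.1 ω.2.2) - x js =
      (w js)⁻¹ • (ω.1 (M js) : Matrix (Fin d) (Fin d) ℝ)ᵀ *ᵥ
      ((ω.2.2 js : Matrix (Fin d) (Fin d) ℝ) *ᵥ (w js • objB M x ω js) + restB M x w js ω) := by
    have h4 : (4 / w js) • (ω.1 (M js) : Matrix (Fin d) (Fin d) ℝ)ᵀ.mulVec
        (sketchB M x w ω.1 ω.2.1 ω.2.2) = (w js)⁻¹ • (ω.1 (M js) : Matrix (Fin d) (Fin d) ℝ)ᵀ *ᵥ
         ((4 : ℝ) • sketchB M x w ω.1 ω.2.1 ω.2.2) := by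
      rw [Matrix.mulVec_smul, smul_smul]
      congr 1
      ring
    rw [h4, four_sketch M x w js ω, Matrix.mulVec_add, Matrix.mulVec_smul, OG_tmul, smul_add,
      smul_smul, inv_mul_cancel₀ hw.ne', one_smul, add_sub_cancel_left]
  have key : ∀ y : Fin d → ℝ, ((ω.1 (M js) : Matrix (Fin d) (Fin d) ℝ)ᵀ *ᵥ y) i =
      ((ω.1 (M js) : Matrix (Fin d) (Fin d) ℝ) *ᵥ Pi.single i 1) ⬝ᵥ y := by
    intro y
    rw [Matrix.mulVec_single_one]
    rfl
  rw [h, Pi.smul_apply, key, dotProduct_add, smul_eq_mul,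
    dotProduct_comm (restB M x w js ω)]
  field_simp

lemma cont_obj {N d m : ℕ} (M : Fin m → Fin N) (x : Fin m → Fin d → ℝ) (j : Fin m) :
    Continuous fun ω : Om N d m => objB M x ω j := by
  unfold objB
  refine Continuous.add (Continuous.matrix_mulVec ?_ continuous_const)
    (Continuous.matrix_mulVec ?_ continuous_const)
  · exact continuous_subtype_val.comp ((continuous_apply _).comp continuous_fst)
  · exact continuous_subtype_val.comp ((continuous_apply _).comp
      (continuous_fst.comp continuous_snd))

lemma cont_Rt {N d m : ℕ} (j : Fin m) :
    Continuous fun ω : Om N d m => (ω.2.2 j : Matrix (Fin d) (Fin d) ℝ) :=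
  continuous_subtype_val.comp ((continuous_apply _).comp (continuous_snd.comp continuous_snd))

lemma cont_R2 {N d m : ℕ} (j : Fin N) :
    Continuous fun ω : Om N d m => (ω.2.1 j : Matrix (Fin d) (Fin d) ℝ) :=
  continuous_subtype_val.comp ((continuous_apply _).comp (continuous_fst.comp continuous_snd))

lemma cont_R1 {N d m : ℕ} (j : Fin N) :
    Continuous fun ω : Om N d m => (ω.1 j : Matrix (Fin d) (Fin d) ℝ) :=
  continuous_subtype_val.comp ((continuous_apply _).comp continuous_fst)

lemma cont_rest {N d m : ℕ} (M : Fin m → Fin N) (x : Fin m → Fin d → ℝ) (w : Fin m → ℝ)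
    (js : Fin m) : Continuous fun ω : Om N d m => restB M x w js ω := by
  unfold restB
  refine Continuous.add ?_ ?_
  · exact Continuous.const_smul (Continuous.matrix_mulVec (cont_R2 _) continuous_const) (w js)
  refine continuous_finsetSum _ fun j _ => ?_
  exact Continuous.const_smul
    ((cont_obj M x j).add (Continuous.matrix_mulVec (cont_Rt j) (cont_obj M x j))) (w j)

noncomputable abbrev PB (N m : ℕ) {d : ℕ} (μ : Measure (OG d)) : Measure (Om N d m) :=
  (Measure.pi fun _ : Fin N => μ).prod
            ((Measure.pi fun _ : Fin N => μ).prod (Measure.pi fun _ : Fin m => μ))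

lemma PB_inv {N d m : ℕ} (μ : Measure (OG d)) [μ.IsMulLeftInvariant]
    [IsProbabilityMeasure μ] : (PB N m μ).IsMulLeftInvariant := by
  have hMu : MeasurableMul (OG d) := inferInstance
  have h1 : ∀ n : ℕ, (Measure.pi fun _ : Fin n => μ).IsMulLeftInvariant := fun n =>
    Measure.pi.isMulLeftInvariant _
  have h2 := h1 N
  have h3 := h1 m
  have h4 := Measure.prod.instIsMulLeftInvariant (μ := Measure.pi fun _ : Fin N => μ)
    (ν := Measure.pi fun _ : Fin m => μ)
  exact Measure.prod.instIsMulLeftInvariant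

lemma dot_mul_le {d : ℕ} (u v : Fin d → ℝ) (hu : nrm u ≤ 1) (hv : nrm v ≤ 4) :
    (u ⬝ᵥ u) * (v ⬝ᵥ v) ≤ 16 := by
  rw [← nrm_sq, ← nrm_sq]
  have := nrm_nonneg u
  have := nrm_nonneg v
  have h1 : nrm u ^ 2 ≤ 1 := by nlinarith
  have h2 : nrm v ^ 2 ≤ 16 := by nlinarith
  nlinarith [sq_nonneg (nrm v)]

lemma nrm_single {d : ℕ} (i : Fin d) : nrm (Pi.single i 1 : Fin d → ℝ) = 1 := by
  apply nrm_unit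
  rw [sqNorm, Finset.sum_eq_single i]
  · simp
  · intro b _ hb
    simp [hb]
  · simp

lemma tailA {N d m : ℕ} (hd : 0 < d) (μ : Measure (OG d)) [μ.IsMulLeftInvariant]
    [IsProbabilityMeasure μ] (M : Fin m → Fin N) (x : Fin m → Fin d → ℝ)
    (hx : ∀ j, sqNorm (x j) = 1) (w : Fin m → ℝ) (hw : ∀ j, 0 ≤ w j) (hw1 : ∑ j, w j = 1)
    (js : Fin m) (i : Fin d) (T : ℝ) (hT : 0 ≤ T) (σ : ℝ)
    (hσ : |σ| = 1) : PB N m μ {ω | T / Real.sqrt d <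
    σ * (((ω.1 (M js) : Matrix (Fin d) (Fin d) ℝ) *ᵥ Pi.single i 1) ⬝ᵥ
      ((ω.2.2 js : Matrix (Fin d) (Fin d) ℝ) *ᵥ (w js • objB M x ω js)))} ≤
      ENNReal.ofReal (Real.exp (- T ^ 2 / (2 * 16))) := by
  have hmeas : Measurable fun q : OG d => ((1, 1, Pi.mulSingle js q) : Om N d m) := by
    refine measurable_const.prodMk (measurable_const.prodMk ?_)
    exact (continuous_mulSingle js).measurable
  have hL : (PB N m μ).IsMulLeftInvariant := PB_inv μ
  refine translate_bound μ (PB N m μ) (fun q => (1, 1, Pi.mulSingle js q)) hmeas _ ?_ _ ?_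
  · refine measurableSet_lt measurable_const (Continuous.measurable ?_)
    refine continuous_const.mul (Continuous.dotProduct
      (Continuous.matrix_mulVec (cont_R1 _) continuous_const)
      (Continuous.matrix_mulVec (cont_Rt _) ((cont_obj M x js).const_smul (w js))))
  · intro ω
    have h := tail_bound hd μ (σ • ((ω.1 (M js) : Matrix (Fin d) (Fin d) ℝ) *ᵥ Pi.single i 1))
      ((ω.2.2 js : Matrix (Fin d) (Fin d) ℝ) *ᵥ (w js • objB M x ω js)) 16 T hT (by norm_num)
      (dot_mul_le _ _ ?_ ?_)
    · refine (measure_mono ?_).trans h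
      intro q hq
      simp only [Set.mem_ofPred_eq] at hq ⊢
      have hobj : objB M x ((1, 1, Pi.mulSingle js q) * ω) js = objB M x ω js := by
        simp [objB]
      rw [hobj] at hq
      simp only [Prod.fst_mul, Prod.snd_mul, Pi.mul_apply, Pi.one_apply, one_mul, Pi.mulSingle_eq_same,
        Submonoid.coe_mul, one_mul] at hq
      rw [smul_dotProduct, smul_eq_mul, Matrix.mulVec_mulVec]
      exact hq
    · rw [nrm_smul, hσ, nrm_OG, nrm_single]; norm_num
    · rw [nrm_OG, nrm_smul, abs_of_nonneg (hw js)]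
      have h1 : w js ≤ 1 := by
        rw [← hw1]; exact Finset.single_le_sum (fun j _ => hw j) (Finset.mem_univ js)
      nlinarith [nrm_objB hd M x hx ω js, nrm_nonneg (objB M x ω js), hw js]

lemma tailB {N d m : ℕ} (hd : 0 < d) (μ : Measure (OG d)) [μ.IsMulLeftInvariant]
    [IsProbabilityMeasure μ] (M : Fin m → Fin N) (x : Fin m → Fin d → ℝ)
    (hx : ∀ j, sqNorm (x j) = 1) (w : Fin m → ℝ) (hw : ∀ j, 0 ≤ w j) (hw1 : ∑ j, w j = 1)
    (js : Fin m) (hjs : ∀ j, M j = M js → j = js) (i : Fin d) (T : ℝ) (hT : 0 ≤ T) (σ : ℝ)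
    (hσ : |σ| = 1) : PB N m μ {ω | T / Real.sqrt d <
    σ * (restB M x w js ω ⬝ᵥ ((ω.1 (M js) : Matrix (Fin d) (Fin d) ℝ) *ᵥ Pi.single i 1))} ≤
      ENNReal.ofReal (Real.exp (- T ^ 2 / (2 * 16))) := by
  have hmeas : Measurable fun q : OG d => ((Pi.mulSingle (M js) q, 1, 1) : Om N d m) := by
    refine Measurable.prodMk ?_ measurable_const
    exact (continuous_mulSingle (M js)).measurable
  have hL : (PB N m μ).IsMulLeftInvariant := PB_inv μ
  refine translate_bound μ (PB N m μ) (fun q => (Pi.mulSingle (M js) q, 1, 1)) hmeas _ ?_ _ ?_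
  · refine measurableSet_lt measurable_const (Continuous.measurable ?_)
    refine continuous_const.mul (Continuous.dotProduct (cont_rest M x w js)
      (Continuous.matrix_mulVec (cont_R1 _) continuous_const))
  · intro ω
    have h := tail_bound hd μ (σ • restB M x w js ω)
      ((ω.1 (M js) : Matrix (Fin d) (Fin d) ℝ) *ᵥ Pi.single i 1) 16 T hT (by norm_num)
      ?_
    · refine (measure_mono ?_).trans h
      intro q hq
      simp only [Set.mem_ofPred_eq] at hq ⊢
      have hobj : ∀ j, j ≠ js →
          objB M x ((Pi.mulSingle (M js) q, 1, 1) * ω) j = objB M x ω j := by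
        intro j hj
        have : M j ≠ M js := fun h => hj (hjs j h)
        simp [objB, Pi.mulSingle_eq_of_ne this]
      have hrest : restB M x w js ((Pi.mulSingle (M js) q, 1, 1) * ω) = restB M x w js ω := by
        unfold restB
        congr 1
        · simp
        · refine Finset.sum_congr rfl fun j hj => ?_
          rw [hobj j (Finset.ne_of_mem_erase hj)]
          simp
      rw [hrest] at hq
      simp only [Prod.fst_mul, Pi.mul_apply, Pi.mulSingle_eq_same,
        Submonoid.coe_mul, one_mul] at hq
      rw [smul_dotProduct, smul_eq_mul, Matrix.mulVec_mulVec]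
      exact hq
    · rw [mul_comm]
      refine dot_mul_le _ _ ?_ ?_
      · rw [nrm_OG, nrm_single]
      · rw [nrm_smul, hσ, one_mul]
        exact nrm_restB hd M x hx w hw hw1 js ω

/-- **Prototype B attribute recovery, case (i).** For every constant `k ≥ 1` there are
constants `C ≥ 1`, `c > 0` such that: with all module matrices `R_{M,1}, R_{M,2}` and tuple
matrices `R_j` independent Haar-random orthogonal matrices, if module `M⋆` produces exactly
one object `j⋆`, which has positive weight `w_{j⋆}`, then
`Pr[ ‖(4/w_{j⋆})·R_{M⋆,1}ᵀ s − x_{j⋆}‖_∞ > C·√(log N)/(w_{j⋆}·√d) ] ≤ N^{−c}`. -/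
theorem prototypeB_attribute_recovery (k : ℕ) (hk : 1 ≤ k) :
    ∃ C : ℝ, 1 ≤ C ∧ ∃ c : ℝ, 0 < c ∧
      ∀ (N d m : ℕ), 2 ≤ N → d ≤ N ^ k → m ≤ N →
      ∀ M : Fin m → Fin N,
      ∀ x : Fin m → Fin d → ℝ, (∀ j, sqNorm (x j) = 1) →
      ∀ w : Fin m → ℝ, (∀ j, 0 ≤ w j) → (∑ j, w j) = 1 →
      ∀ μ : Measure (Matrix.orthogonalGroup (Fin d) ℝ),
        μ.IsHaarMeasure → IsProbabilityMeasure μ →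
      ∀ (Mstar : Fin N) (jstar : Fin m), M jstar = Mstar → 0 < w jstar →
        (∀ j, M j = Mstar → j = jstar) →
        (((Measure.pi fun _ : Fin N => μ).prod
            ((Measure.pi fun _ : Fin N => μ).prod (Measure.pi fun _ : Fin m => μ)))
            {ω : (Fin N → Matrix.orthogonalGroup (Fin d) ℝ) ×
                (Fin N → Matrix.orthogonalGroup (Fin d) ℝ) ×
                (Fin m → Matrix.orthogonalGroup (Fin d) ℝ) |
              C * Real.sqrt (Real.log N) / (w jstar * Real.sqrt d) <
                linf ((4 / w jstar) •
                    (ω.1 Mstar : Matrix (Fin d) (Fin d) ℝ)ᵀ.mulVec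
                      (sketchB M x w ω.1 ω.2.1 ω.2.2)
                  - x jstar)})
          ≤ ENNReal.ofReal ((N : ℝ) ^ (-c : ℝ)) := by
  refine ⟨16 * (k + 3), by have : (0 : ℝ) ≤ k := k.cast_nonneg; linarith, 1, one_pos, ?_⟩
  intro N d m hN hdN hmN M x hx w hw hw1 μ hμ hμP Mstar jstar hM hwj huniq
  subst hM
  have hd : 0 < d := by
    rcases Nat.eq_zero_or_pos d with h | h
    · subst h
      have := hx jstar
      simp [sqNorm] at this
    · exact h
  have hinv : μ.IsMulLeftInvariant := hμ.toIsMulLeftInvariant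
  have : Nonempty (Fin d) := ⟨⟨0, hd⟩⟩
  have hNR : (2 : ℝ) ≤ N := by exact_mod_cast hN
  have hN0 : (0 : ℝ) < N := by linarith
  have hlog : 0 ≤ Real.log N := Real.log_nonneg (by linarith)
  have hkR : (0 : ℝ) ≤ k := k.cast_nonneg
  set T : ℝ := 8 * (k + 3) * Real.sqrt (Real.log N) with hT
  have hT0 : 0 ≤ T := by positivity
  have hs0 : 0 < Real.sqrt d := Real.sqrt_pos.2 (by exact_mod_cast hd)
  set A : Om N d m → Fin d → ℝ := fun ω i =>
    (((ω.1 (M jstar) : Matrix (Fin d) (Fin d) ℝ) *ᵥ Pi.single i 1) ⬝ᵥ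
      ((ω.2.2 jstar : Matrix (Fin d) (Fin d) ℝ) *ᵥ (w jstar • objB M x ω jstar))) with hA
  set B : Om N d m → Fin d → ℝ := fun ω i =>
    restB M x w jstar ω ⬝ᵥ ((ω.1 (M jstar) : Matrix (Fin d) (Fin d) ℝ) *ᵥ Pi.single i 1) with hB
  set b : ENNReal := ENNReal.ofReal (Real.exp (- T ^ 2 / (2 * 16))) with hb
  have hA1 : ∀ i, PB N m μ {ω | T / Real.sqrt d < 1 * A ω i} ≤ b := fun i =>
    tailA hd μ M x hx w hw hw1 jstar i T hT0 1 (by simp)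
  have hA2 : ∀ i, PB N m μ {ω | T / Real.sqrt d < (-1) * A ω i} ≤ b := fun i =>
    tailA hd μ M x hx w hw hw1 jstar i T hT0 (-1) (by simp)
  have hB1 : ∀ i, PB N m μ {ω | T / Real.sqrt d < 1 * B ω i} ≤ b := fun i =>
    tailB hd μ M x hx w hw hw1 jstar huniq i T hT0 1 (by simp)
  have hB2 : ∀ i, PB N m μ {ω | T / Real.sqrt d < (-1) * B ω i} ≤ b := fun i =>
    tailB hd μ M x hx w hw hw1 jstar huniq i T hT0 (-1) (by simp)
  have hsub : {ω : Om N d m |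
              16 * (k + 3) * Real.sqrt (Real.log N) / (w jstar * Real.sqrt d) <
                linf ((4 / w jstar) •
                    (ω.1 (M jstar) : Matrix (Fin d) (Fin d) ℝ)ᵀ.mulVec
                      (sketchB M x w ω.1 ω.2.1 ω.2.2)
                  - x jstar)} ⊆ ⋃ i : Fin d,
        (({ω | T / Real.sqrt d < 1 * A ω i} ∪ {ω | T / Real.sqrt d < (-1) * A ω i}) ∪
        ({ω | T / Real.sqrt d < 1 * B ω i} ∪ {ω | T / Real.sqrt d < (-1) * B ω i})) := by
    intro ω hω
    simp only [Set.mem_ofPred_eq, linf] at hω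
    obtain ⟨i, hi⟩ := exists_lt_of_lt_ciSup hω
    rw [err_eq M x w jstar hwj ω i] at hi
    change _ < |(A ω i + B ω i) / w jstar| at hi
    rw [abs_div, abs_of_pos hwj, lt_div_iff₀ hwj] at hi
    have h2 : 16 * (k + 3) * Real.sqrt (Real.log N) / (w jstar * Real.sqrt d) * w jstar =
        T / Real.sqrt d + T / Real.sqrt d := by
      rw [hT]; field_simp; ring
    rw [h2] at hi
    refine Set.mem_iUnion.2 ⟨i, ?_⟩
    by_contra hcon
    simp only [Set.mem_union, Set.mem_ofPred_eq, not_or, not_lt] at hcon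
    obtain ⟨⟨h3, h4⟩, h5, h6⟩ := hcon
    have : |A ω i + B ω i| ≤ T / Real.sqrt d + T / Real.sqrt d := by
      rw [abs_le]
      constructor <;> linarith
    linarith
  refine (measure_mono hsub).trans ((measure_iUnion_le _).trans ?_)
  rw [tsum_fintype]
  have h4 : ∀ i ∈ (Finset.univ : Finset (Fin d)), PB N m μ
      (({ω | T / Real.sqrt d < 1 * A ω i} ∪ {ω | T / Real.sqrt d < (-1) * A ω i}) ∪
        ({ω | T / Real.sqrt d < 1 * B ω i} ∪ {ω | T / Real.sqrt d < (-1) * B ω i})) ≤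
        (b + b) + (b + b) := by
    intro i _
    refine (measure_union_le _ _).trans (add_le_add ((measure_union_le _ _).trans
      (add_le_add (hA1 i) (hA2 i))) ((measure_union_le _ _).trans
      (add_le_add (hB1 i) (hB2 i))))
  refine (Finset.sum_le_sum h4).trans ?_
  have hbN : Real.exp (- T ^ 2 / (2 * 16)) ≤ (N : ℝ) ^ (-((k : ℝ) + 3)) := by
    rw [Real.rpow_def_of_pos hN0]
    refine Real.exp_le_exp.2 ?_
    rw [hT, mul_pow, Real.sq_sqrt hlog]
    have : (0 : ℝ) ≤ Real.log N * ((k + 3) * (2 * (k + 3) - 1)) := by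
      have : (0 : ℝ) ≤ 2 * (k + 3) - 1 := by linarith
      positivity
    nlinarith
  have hfin : (d : ℝ) * (4 * Real.exp (- T ^ 2 / (2 * 16))) ≤ (N : ℝ) ^ (-1 : ℝ) := by
    have e1 : (d : ℝ) ≤ (N : ℝ) ^ (k : ℝ) := by
      rw [Real.rpow_natCast]; exact_mod_cast hdN
    have e2 : (4 : ℝ) ≤ (N : ℝ) ^ (2 : ℝ) := by
      rw [Real.rpow_two]; nlinarith
    calc (d : ℝ) * (4 * Real.exp (- T ^ 2 / (2 * 16)))
        ≤ (N : ℝ) ^ (k : ℝ) * ((N : ℝ) ^ (2 : ℝ) * (N : ℝ) ^ (-((k : ℝ) + 3))) := by gcongr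
      _ = _ := by
        rw [← Real.rpow_add hN0, ← Real.rpow_add hN0]
        congr 1
        ring
  refine le_trans (le_of_eq ?_) (ENNReal.ofReal_le_ofReal hfin)
  rw [ENNReal.ofReal_mul (Nat.cast_nonneg d), ENNReal.ofReal_mul (by norm_num), ← hb]
  simp only [Finset.sum_const, Finset.card_univ, Fintype.card_fin, nsmul_eq_mul,
    ENNReal.ofReal_natCast, ENNReal.ofReal_ofNat]
  congr 1
  ring
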